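/- For every k ≥ 3, setting n = 2k + 1, there exists a family R assigning to each i ∈ Fin n a ternary relation R i on Fin n such that: (a) no configuration P : Fin n → ℝ² (injective, in general position) satisfies ccw_P(i;j,k',l) ↔ R i j k' l for all admissible quadruples (i,j,k',l); and (b) for every index m ∈ Fin n there exists a configuration P on the index set {x : Fin n // x ≠ m} (injective, in general position) such that for all pairwise distinct indices i,j,k',l different from m one has ccw_P(i;j,k',l) ↔ R i j k' l. In other words, there are arbitrarily large radial systems that are not realizable by any planar point set but become realizable upon removal of any single point. -/

import Mathlib

noncomputable def det2 (v w : ℝ × ℝ) : ℝ := v.1 * w.2 - v.2 * w.1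

noncomputable def chi {α : Type*} (P : α → ℝ × ℝ) (i j k : α) : ℝ :=
  Real.sign (det2 (P j - P i) (P k - P i))

def GenPos {α : Type*} (P : α → ℝ × ℝ) : Prop :=
  ∀ i j k : α, i ≠ j → i ≠ k → j ≠ k → chi P i j k ≠ 0

def Ccw {α : Type*} (P : α → ℝ × ℝ) (i j k l : α) : Prop :=
  (chi P i j k = 1 ∧ chi P i k l = 1) ∨
  (chi P i k l = 1 ∧ chi P i l j = 1) ∨
  (chi P i l j = 1 ∧ chi P i j k = 1)

def Admissible {α : Type*} (i j k l : α) : Prop :=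
  i ≠ j ∧ i ≠ k ∧ i ≠ l ∧ j ≠ k ∧ j ≠ l ∧ k ≠ l

def SameRadial {α : Type*} (P Q : α → ℝ × ℝ) : Prop :=
  ∀ i j k l : α, Admissible i j k l → (Ccw P i j k l ↔ Ccw Q i j k l)

def SameUndirected {α : Type*} (P Q : α → ℝ × ℝ) : Prop :=
  ∀ i : α, (∀ j k l : α, Admissible i j k l → (Ccw Q i j k l ↔ Ccw P i j k l)) ∨
           (∀ j k l : α, Admissible i j k l → (Ccw Q i j k l ↔ Ccw P i l k j))

def ExtremeSet {α : Type*} (P : α → ℝ × ℝ) : Set α :=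
  {i | P i ∉ convexHull ℝ (P '' {j | j ≠ i})}

def Important {n : ℕ} (P₀ : Fin n → ℝ × ℝ) (H : Set (Fin n)) : Prop :=
  ∃ Q : Fin n → ℝ × ℝ, Function.Injective Q ∧ GenPos Q ∧ SameRadial P₀ Q ∧ ExtremeSet Q = H

def lineThrough (p q : ℝ × ℝ) : Set (ℝ × ℝ) := {x | ∃ t : ℝ, x = p + t • (q - p)}

namespace RadialSystem

/-- At least two of three propositions hold. -/
def TwoOf (p q r : Prop) : Prop := (p ∧ q) ∨ (q ∧ r) ∨ (r ∧ p)

/-- The cyclic order on `ℕ`. -/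
def Cyc (a b d : ℕ) : Prop := (a < b ∧ b < d) ∨ (b < d ∧ d < a) ∨ (d < a ∧ a < b)

/-- `o` is odd and `e` is one of its two neighbours in the cycle `0, 1, …, 2k - 1`. -/
def Nbr (k o e : ℕ) : Prop :=
  o % 2 = 1 ∧ (e + 1 = o ∨ e = o + 1 ∨ (o + 1 = 2 * k ∧ e = 0))

/-- The triple consists of an odd vertex of the cycle and its two neighbours. -/
def Reflex (k a b d : ℕ) : Prop :=
  (Nbr k a b ∧ Nbr k a d) ∨ (Nbr k b a ∧ Nbr k b d) ∨ (Nbr k d a ∧ Nbr k d b)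

/-- Orientation of triples of a convex `2k`-gon whose odd vertices have been pushed
slightly inside the edge spanned by their neighbours. -/
def Pos (k a b d : ℕ) : Prop := (Cyc a b d ↔ ¬ Reflex k a b d)

/-- Radial relation around the polygon vertex `a` of the outer vertex and `b`, `d`. -/
def OuterPos (k a b d : ℕ) : Prop := (a % 2 = 1 ∧ Cyc a b d) ∨ (a % 2 = 0 ∧ Pos k a b d)

/-- The radial system: the polygon described by `Pos`, together with an outer vertex `2k`
that sees the polygon clockwise and is seen from each polygon vertex in the outward direction. -/
def Radial (k i j l r : ℕ) : Prop :=
  (i = 2 * k ∧ Cyc r l j) ∨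
  (i ≠ 2 * k ∧ j = 2 * k ∧ OuterPos k i l r) ∨
  (i ≠ 2 * k ∧ l = 2 * k ∧ OuterPos k i r j) ∨
  (i ≠ 2 * k ∧ r = 2 * k ∧ OuterPos k i j l) ∨
  (i ≠ 2 * k ∧ j ≠ 2 * k ∧ l ≠ 2 * k ∧ r ≠ 2 * k ∧
    TwoOf (Pos k i j l) (Pos k i l r) (Pos k i r j))

lemma radial_outer_iff {k j l r : ℕ} : Radial k (2 * k) j l r ↔ Cyc r l j := by
  simp [Radial]

lemma radial_iff_outerPos₁ {k i l r : ℕ} (hi : i ≠ 2 * k) (hl : l ≠ 2 * k) (hr : r ≠ 2 * k) :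
    Radial k i (2 * k) l r ↔ OuterPos k i l r := by
  simp [Radial, hi, hl, hr]

lemma radial_iff_outerPos₂ {k i j r : ℕ} (hi : i ≠ 2 * k) (hj : j ≠ 2 * k) (hr : r ≠ 2 * k) :
    Radial k i j (2 * k) r ↔ OuterPos k i r j := by
  simp [Radial, hi, hj, hr]

lemma radial_iff_outerPos₃ {k i j l : ℕ} (hi : i ≠ 2 * k) (hj : j ≠ 2 * k) (hl : l ≠ 2 * k) :
    Radial k i j l (2 * k) ↔ OuterPos k i j l := by
  simp [Radial, hi, hj, hl]

lemma radial_iff_twoOf {k i j l r : ℕ} (hi : i ≠ 2 * k) (hj : j ≠ 2 * k) (hl : l ≠ 2 * k)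
    (hr : r ≠ 2 * k) :
    Radial k i j l r ↔ TwoOf (Pos k i j l) (Pos k i l r) (Pos k i r j) := by
  simp [Radial, hi, hj, hl, hr]

/-! ### Orientations in the plane -/

/-- Twice the signed area of a triangle. -/
noncomputable def orient (A B C : ℝ × ℝ) : ℝ := det2 (B - A) (C - A)

lemma orient_eq (A B C : ℝ × ℝ) :
    orient A B C = (B.1 - A.1) * (C.2 - A.2) - (B.2 - A.2) * (C.1 - A.1) := rfl

lemma orient_rotate (A B C : ℝ × ℝ) : orient B C A = orient A B C := by
  simp only [orient_eq]; ring

lemma orient_swap (A B C : ℝ × ℝ) : orient B A C = -orient A B C := by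
  simp only [orient_eq]; ring

lemma orient_swap' (A B C : ℝ × ℝ) : orient A C B = -orient A B C := by
  simp only [orient_eq]; ring

lemma orient_add (A B C D : ℝ × ℝ) :
    orient A B C + orient A C D + orient A D B = orient B C D := by
  simp only [orient_eq]; ring

lemma sign_eq_one_iff (x : ℝ) : Real.sign x = 1 ↔ 0 < x := by
  rcases lt_trichotomy x 0 with h | h | h
  · rw [Real.sign_of_neg h]; constructor <;> intro h' <;> linarith
  · simp [h]
  · simp [Real.sign_of_pos h, h]

lemma chi_eq_one_iff {α : Type*} (P : α → ℝ × ℝ) (i j k : α) :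
    chi P i j k = 1 ↔ 0 < orient (P i) (P j) (P k) := sign_eq_one_iff _

lemma chi_ne_zero_iff {α : Type*} (P : α → ℝ × ℝ) (i j k : α) :
    chi P i j k ≠ 0 ↔ orient (P i) (P j) (P k) ≠ 0 := Real.sign_eq_zero_iff.not

lemma ccw_iff {α : Type*} (P : α → ℝ × ℝ) (i j k l : α) :
    Ccw P i j k l ↔ TwoOf (0 < orient (P i) (P j) (P k)) (0 < orient (P i) (P k) (P l))
      (0 < orient (P i) (P l) (P j)) := by
  simp only [Ccw, TwoOf, chi_eq_one_iff]

/-- Four points whose radial relations are those of a convex quadrilateral form one. -/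
lemma orient_pos_of_ccw {α : Type*} {P : α → ℝ × ℝ} (hP : GenPos P) {a b c d : α}
    (hab : a ≠ b) (hac : a ≠ c) (had : a ≠ d) (hbc : b ≠ c) (hbd : b ≠ d) (hcd : c ≠ d)
    (ha : Ccw P a b c d) (hb : Ccw P b c d a) (hc : Ccw P c d a b) :
    0 < orient (P a) (P b) (P c) ∧ 0 < orient (P a) (P c) (P d) ∧
      0 < orient (P a) (P b) (P d) ∧ 0 < orient (P b) (P c) (P d) := by
  have h1 := (chi_ne_zero_iff P a b c).1 (hP a b c hab hac hbc)
  have h2 := (chi_ne_zero_iff P a c d).1 (hP a c d hac had hcd)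
  have h3 := (chi_ne_zero_iff P a b d).1 (hP a b d hab had hbd)
  have h4 := (chi_ne_zero_iff P b c d).1 (hP b c d hbc hbd hcd)
  simp only [ccw_iff, TwoOf] at ha hb hc
  rw [orient_swap' (P a) (P b) (P d)] at ha
  rw [orient_rotate (P a) (P b) (P d), orient_swap (P a) (P b) (P c)] at hb
  rw [orient_rotate (P a) (P c) (P d), ← orient_rotate (P c) (P a) (P b),
    orient_swap (P b) (P c) (P d)] at hc
  simp only [Left.neg_pos_iff] at ha hb hc
  rcases h1.lt_or_gt with h1 | h1 <;> rcases h2.lt_or_gt with h2 | h2 <;>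
    rcases h3.lt_or_gt with h3 | h3 <;> rcases h4.lt_or_gt with h4 | h4 <;>
    simp_all [not_lt_of_gt]

/-! ### Nonrealizability -/

lemma orient_pos_of_radial {k : ℕ} {P : Fin (2 * k + 1) → ℝ × ℝ} (hP : GenPos P)
    (hR : ∀ i j l r : Fin (2 * k + 1), Admissible i j l r → (Ccw P i j l r ↔ Radial k i j l r))
    {a b c d : ℕ} (ha : a < 2 * k + 1) (hb : b < 2 * k + 1) (hc : c < 2 * k + 1)
    (hd : d < 2 * k + 1) (hab : a ≠ b) (hac : a ≠ c) (had : a ≠ d) (hbc : b ≠ c) (hbd : b ≠ d)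
    (hcd : c ≠ d) (hRa : Radial k a b c d) (hRb : Radial k b c d a) (hRc : Radial k c d a b) :
    0 < orient (P ⟨a, ha⟩) (P ⟨b, hb⟩) (P ⟨c, hc⟩) ∧
      0 < orient (P ⟨a, ha⟩) (P ⟨c, hc⟩) (P ⟨d, hd⟩) ∧
      0 < orient (P ⟨a, ha⟩) (P ⟨b, hb⟩) (P ⟨d, hd⟩) ∧
      0 < orient (P ⟨b, hb⟩) (P ⟨c, hc⟩) (P ⟨d, hd⟩) := by
  have key : ∀ i j l r : Fin (2 * k + 1), i.1 ≠ j.1 → i.1 ≠ l.1 → i.1 ≠ r.1 → j.1 ≠ l.1 →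
      j.1 ≠ r.1 → l.1 ≠ r.1 → Radial k i j l r → Ccw P i j l r := by
    intro i j l r h1 h2 h3 h4 h5 h6
    refine (hR i j l r ⟨?_, ?_, ?_, ?_, ?_, ?_⟩).2 <;> rwa [Ne, Fin.ext_iff]
  refine orient_pos_of_ccw hP ?_ ?_ ?_ ?_ ?_ ?_ (key _ _ _ _ ?_ ?_ ?_ ?_ ?_ ?_ hRa)
    (key _ _ _ _ ?_ ?_ ?_ ?_ ?_ ?_ hRb) (key _ _ _ _ ?_ ?_ ?_ ?_ ?_ ?_ hRc) <;> simp <;> omega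

/-- The outer vertex, an odd vertex and its two neighbours are in convex position. -/
lemma radial_outer {k i e : ℕ} (hk : 3 ≤ k) (hi : i < k)
    (he : (e = 2 * i + 2 ∧ e < 2 * k) ∨ (i + 1 = k ∧ e = 0)) :
    Radial k (2 * k) e (2 * i + 1) (2 * i) ∧ Radial k e (2 * i + 1) (2 * i) (2 * k) ∧
      Radial k (2 * i + 1) (2 * i) (2 * k) e := by
  rw [radial_outer_iff, radial_iff_outerPos₃ (by omega) (by omega) (by omega),
    radial_iff_outerPos₂ (by omega) (by omega) (by omega)]
  have hr : Reflex k e (2 * i + 1) (2 * i) :=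
    .inr (.inl ⟨⟨by omega, by omega⟩, by omega, by omega⟩)
  simp only [OuterPos, Pos, hr, Cyc, not_true_eq_false, iff_false]
  refine ⟨?_, ?_, ?_⟩ <;> omega

/-- Four polygon vertices in increasing order that contain no reflex triple. -/
lemma radial_inner {k a b c d : ℕ} (hab : a < b) (hbc : b < c) (hcd : c < d)
    (hd : d < 2 * k) (h1 : ¬ Reflex k a b c) (h2 : ¬ Reflex k a c d) (h3 : ¬ Reflex k a b d)
    (h4 : ¬ Reflex k b c d) :
    Radial k a b c d ∧ Radial k b c d a ∧ Radial k c d a b := by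
  have symm : ∀ x y z, (Reflex k y z x ↔ Reflex k x y z) ∧ (Reflex k x z y ↔ Reflex k x y z) := by
    intro x y z
    simp only [Reflex]
    tauto
  simp only [Radial, TwoOf, Pos, Cyc]
  grind

theorem not_realizable {k : ℕ} (hk : 3 ≤ k) (P : Fin (2 * k + 1) → ℝ × ℝ) (hP : GenPos P)
    (hR : ∀ i j l r : Fin (2 * k + 1), Admissible i j l r → (Ccw P i j l r ↔ Radial k i j l r)) :
    False := by
  set Q : ℕ → ℝ × ℝ := fun a ↦ P (Fin.ofNat (2 * k + 1) a) with hQ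
  have hval : ∀ a (h : a < 2 * k + 1), Q a = P ⟨a, h⟩ := by
    intro a h
    simp only [hQ]
    congr
    exact Fin.ext (Nat.mod_eq_of_lt h)
  clear_value Q
  have outer : ∀ i e : ℕ, i < k → ((e = 2 * i + 2 ∧ e < 2 * k) ∨ (i + 1 = k ∧ e = 0)) →
      0 < orient (Q (2 * k)) (Q e) (Q (2 * i + 1)) ∧
      0 < orient (Q (2 * k)) (Q (2 * i + 1)) (Q (2 * i)) ∧
      0 < orient (Q (2 * k)) (Q e) (Q (2 * i)) := by
    intro i e hi he
    obtain ⟨h1, h2, h3⟩ := radial_outer hk hi he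
    rw [hval (2 * k) (by omega), hval e (by omega), hval (2 * i) (by omega),
      hval (2 * i + 1) (by omega)]
    have := orient_pos_of_radial hP hR (a := 2 * k) (b := e) (c := 2 * i + 1) (d := 2 * i)
      (by omega) (by omega) (by omega) (by omega) (by omega) (by omega) (by omega) (by omega)
      (by omega) (by omega) h1 h2 h3
    exact ⟨this.1, this.2.1, this.2.2.1⟩
  have inner : ∀ a b c d : ℕ, a < b → b < c → c < d → d < 2 * k → ¬ Reflex k a b c →
      ¬ Reflex k a c d → ¬ Reflex k a b d → ¬ Reflex k b c d →
      0 < orient (Q a) (Q b) (Q c) ∧ 0 < orient (Q a) (Q c) (Q d) := by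
    intro a b c d hab hbc hcd hd n1 n2 n3 n4
    obtain ⟨h1, h2, h3⟩ := radial_inner hab hbc hcd hd n1 n2 n3 n4
    rw [hval a (by omega), hval b (by omega), hval c (by omega), hval d (by omega)]
    have := orient_pos_of_radial hP hR (a := a) (b := b) (c := c) (d := d)
      (by omega) (by omega) (by omega) (by omega) (by omega) (by omega) (by omega) (by omega)
      (by omega) (by omega) h1 h2 h3
    exact ⟨this.1, this.2.1⟩
  have edge : ∀ a, a + 1 < 2 * k → 0 < orient (Q (2 * k)) (Q (a + 1)) (Q a) := by
    intro a ha
    rcases Nat.even_or_odd' a with ⟨i, rfl | rfl⟩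
    · by_cases h : i + 1 = k
      · exact (outer i 0 (by omega) (.inr ⟨h, rfl⟩)).2.1
      · exact (outer i _ (by omega) (.inl ⟨rfl, by omega⟩)).2.1
    · exact (outer i _ (by omega) (.inl ⟨rfl, by omega⟩)).1
  have tri : ∀ a, 2 ≤ a → a + 3 ≤ 2 * k → 0 < orient (Q 0) (Q a) (Q (a + 1)) := by
    intro a h2 ha
    rcases Nat.even_or_odd' a with ⟨i, rfl | rfl⟩
    · refine (inner 0 (2 * i) (2 * i + 1) (2 * k - 1) ?_ ?_ ?_ ?_ ?_ ?_ ?_ ?_).1 <;>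
        (try simp only [Reflex, Nbr]) <;> omega
    · refine (inner 0 1 (2 * i + 1) (2 * i + 1 + 1) ?_ ?_ ?_ ?_ ?_ ?_ ?_ ?_).2 <;>
        (try simp only [Reflex, Nbr]) <;> omega
  have step : ∀ a, 2 ≤ a → a + 2 ≤ 2 * k → 0 < orient (Q (2 * k)) (Q a) (Q 0) := by
    intro a h2
    induction a, h2 using Nat.le_induction with
    | base => exact fun _ ↦ (outer 0 2 (by omega) (.inl ⟨rfl, by omega⟩)).2.2
    | succ a h2 ih =>
      intro ha
      by_contra hneg
      have hne : orient (Q (2 * k)) (Q (a + 1)) (Q 0) ≠ 0 := by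
        rw [hval (2 * k) (by omega), hval (a + 1) (by omega), hval 0 (by omega)]
        refine (chi_ne_zero_iff P _ _ _).1 (hP _ _ _ ?_ ?_ ?_) <;> simp <;> omega
      have e1 := ih (by omega)
      have e2 := edge a (by omega)
      have e3 := tri a h2 (by omega)
      have hlt := lt_of_le_of_ne (not_lt.1 hneg) hne
      have := orient_add (Q (2 * k)) (Q 0) (Q a) (Q (a + 1))
      rw [orient_swap' (Q (2 * k)) (Q a) (Q 0), orient_swap' _ (Q (a + 1)) (Q a)] at this
      linarith
  have h1 := step (2 * (k - 1)) (by omega) (by omega)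
  have h2 := (outer (k - 1) 0 (by omega) (.inr ⟨by omega, rfl⟩)).2.2
  rw [orient_swap'] at h2
  linarith

/-! ### Realizability of the point deletions -/

/-- The polygon vertex at which the cyclic order is cut open when `m` is deleted. -/
def cut (k m : ℕ) : ℕ := if m = 2 * k then 2 * k - 1 else m

/-- Abscissa of the polygon vertex `a`, and `0` for the outer vertex. -/
def key (k m a : ℕ) : ℤ :=
  if a = 2 * k then 0 else if cut k m < a then (a : ℤ) - cut k m else (a : ℤ) + 2 * k - cut k m

/-- Integral coordinates of a realization of the radial system without `m`. The remaining polygon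
vertices lie on a parabola, the odd ones being lifted, and the outer vertex far below. If `m` is the
outer vertex, the polygon vertex `2k - 1` lies slightly below the segment between its neighbours. -/
def coord (k m a : ℕ) : ℤ × ℤ :=
  if a = 2 * k then (0, -(8 * k ^ 2 + 8 * k))
  else if a = cut k m then (k, 4 * k ^ 2 - 4 * k + 1)
  else (key k m a, 2 * key k m a ^ 2 + 4 * (a % 2 : ℕ))

/-- The integral version of `orient`. -/
def det3 (A B C : ℤ × ℤ) : ℤ := (B.1 - A.1) * (C.2 - A.2) - (B.2 - A.2) * (C.1 - A.1)

/-- Orientation of the triples of `coord k m`. -/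
def CoordPos (k m a b d : ℕ) : Prop :=
  (a = 2 * k ∧ key k m d < key k m b) ∨ (b = 2 * k ∧ key k m a < key k m d) ∨
  (d = 2 * k ∧ key k m b < key k m a) ∨ (a ≠ 2 * k ∧ b ≠ 2 * k ∧ d ≠ 2 * k ∧ Pos k a b d)

lemma chain_pos {p q u v w : ℤ} (hp : 1 ≤ p) (hq : 1 ≤ q) (hu : u = 0 ∨ u = 1)
    (hv : v = 0 ∨ v = 1) (hw : w = 0 ∨ w = 1) (hpm : p % 2 = (u + v) % 2)
    (hqm : q % 2 = (v + w) % 2) (h : ¬ (v = 1 ∧ p = 1 ∧ q = 1)) :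
    0 < p * q * (p + q) + 2 * (p * w + q * u - (p + q) * v) := by
  have hpq : 0 < p * q := by positivity
  have key : 0 < p * q * (p + q) := by positivity
  rcases hv with rfl | rfl
  · rcases hu with rfl | rfl <;> rcases hw with rfl | rfl <;> nlinarith
  · rcases hu with rfl | rfl <;> rcases hw with rfl | rfl
    · rcases (show p ≥ 3 ∨ q ≥ 3 by omega) with h' | h'
      · have : 3 ≤ p * q := by nlinarith
        nlinarith
      · have : 3 ≤ p * q := by nlinarith
        nlinarith
    · have h2 : 2 ≤ q := by omega
      have : 3 ≤ p * (p + q) := by nlinarith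
      nlinarith
    · have h2 : 2 ≤ p := by omega
      have : 3 ≤ q * (p + q) := by nlinarith
      nlinarith
    · nlinarith

lemma sq_add_mul_ge {K x y : ℤ} (hK : 0 ≤ K) (hx : -K ≤ x) (hy : y ≤ K) (hxy : x < y)
    (h : ¬ (x = -K ∧ y = K)) : K ≤ K ^ 2 + x * y := by
  rcases le_or_gt x 0 with h0 | h0
  · rcases hy.lt_or_eq with h1 | rfl
    · rcases le_or_gt y 0 with h2 | h2 <;> nlinarith
    · have : 1 ≤ y + x := by omega
      nlinarith
  · nlinarith

lemma below_aux {K x y : ℤ} (hK : 2 ≤ K) (hx : -K < x) (hy : y ≤ K) (hxy : x < y) :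
    0 < (y - x) * (2 * (K ^ 2 + x * y) - 1) - 4 * y := by
  have hG := sq_add_mul_ge (by linarith) hx.le hy hxy (by omega)
  rcases le_or_gt y 0 with h0 | h0
  · nlinarith
  rcases lt_trichotomy x 0 with h1 | rfl | h1
  · rcases hK.lt_or_eq with h2 | rfl
    · nlinarith
    · obtain rfl : x = -1 := by omega
      interval_cases y <;> norm_num
  · nlinarith
  · have : 4 * y < 2 * (K ^ 2 + x * y) - 1 := by nlinarith
    nlinarith

lemma below_pos {k s t u v : ℤ} (hk : 3 ≤ k) (hst : s < t) (hs : 1 ≤ s) (ht : t ≤ 2 * k - 1)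
    (hu : u = 0 ∨ u = 1) (hv : v = 0 ∨ v = 1) (hsu : s % 2 ≠ u) (htv : t % 2 ≠ v)
    (h : ¬ (s = 1 ∧ t = 2 * k - 1)) :
    0 < (t - s) * (2 * (k - 1) ^ 2 - 1 + 2 * (s - k) * (t - k)) - 4 * u * (t - k)
      + 4 * v * (s - k) := by
  obtain ⟨K, rfl⟩ : ∃ K, k = K + 1 := ⟨k - 1, by ring⟩
  obtain ⟨x, rfl⟩ : ∃ x, s = x + (K + 1) := ⟨s - (K + 1), by ring⟩
  obtain ⟨y, rfl⟩ : ∃ y, t = y + (K + 1) := ⟨t - (K + 1), by ring⟩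
  have hx : -K ≤ x := by linarith
  have hy : y ≤ K := by linarith
  have hxy : x < y := by linarith
  suffices 0 < (y - x) * (2 * (K ^ 2 + x * y) - 1) - 4 * u * y + 4 * v * x by
    convert this using 1
    ring
  rcases hu with rfl | rfl <;> rcases hv with rfl | rfl
  · have := sq_add_mul_ge (by omega) hx hy hxy (by omega)
    nlinarith
  · have := below_aux (K := K) (x := -y) (y := -x) (by omega) (by omega) (by omega) (by omega)
    linarith
  · have := below_aux (K := K) (x := x) (y := y) (by omega) (by omega) (by omega) (by omega)
    linarith
  · have h1 : 0 ≤ (K - 1) ^ 2 + x * y := by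
      by_cases h2 : x = -(K - 1) ∧ y = K - 1
      · rw [h2.1, h2.2]
        linarith
      · have := sq_add_mul_ge (K := K - 1) (by omega) (by omega) (by omega) hxy h2
        linarith
    nlinarith

lemma key_outer (k m : ℕ) : key k m (2 * k) = 0 := by simp [key]

lemma key_bounds {k m a : ℕ} (hk : 3 ≤ k) (hm : m ≤ 2 * k) (ha : a < 2 * k) (ham : a ≠ m) :
    1 ≤ key k m a ∧ key k m a ≤ 2 * k ∧ (key k m a = 2 * k ↔ a = cut k m) ∧
      (key k m a = 2 * k → m = 2 * k) ∧ key k m a % 2 = ((a : ℤ) + cut k m) % 2 := by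
  simp only [key, cut]
  split_ifs <;> omega

lemma key_inj {k m a b : ℕ} (hk : 3 ≤ k) (hm : m ≤ 2 * k) (ha : a < 2 * k + 1)
    (hb : b < 2 * k + 1) (h : key k m a = key k m b) : a = b := by
  revert h
  simp only [key, cut]
  split_ifs <;> omega

lemma pos_iff_of_key {k m a b d : ℕ} (hk : 3 ≤ k) (hm : m ≤ 2 * k) (ha : a < 2 * k)
    (hb : b < 2 * k) (hd : d < 2 * k) (hdm : d ≠ m)
    (hab : key k m a < key k m b) (hbd : key k m b < key k m d) :
    Pos k a b d ↔ ¬ ((b % 2 = 1 ∧ key k m b = key k m a + 1 ∧ key k m d = key k m b + 1) ∨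
      (m = 2 * k ∧ key k m a = 1 ∧ key k m b = 2 * k - 1 ∧ key k m d = 2 * k)) := by
  have hcyc : Cyc a b d := by
    revert hab hbd
    simp only [key, cut, Cyc]
    split_ifs <;> omega
  have hr : Reflex k a b d ↔
      (b % 2 = 1 ∧ key k m b = key k m a + 1 ∧ key k m d = key k m b + 1) ∨
      (m = 2 * k ∧ key k m a = 1 ∧ key k m b = 2 * k - 1 ∧ key k m d = 2 * k) := by
    revert hab hbd
    simp only [key, cut, Reflex, Nbr]
    split_ifs <;> omega
  simp only [Pos, hcyc, hr, true_iff]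

lemma coord_outer (k m : ℕ) : coord k m (2 * k) = (0, -(8 * (k : ℤ) ^ 2 + 8 * k)) := by
  simp [coord]

lemma coord_chain {k m a : ℕ} (ha : a ≠ 2 * k) (hc : a ≠ cut k m) :
    coord k m a = (key k m a, 2 * key k m a ^ 2 + 4 * ((a : ℤ) % 2)) := by
  simp [coord, ha, hc]

lemma coord_cut {k m : ℕ} (ha : cut k m ≠ 2 * k) :
    coord k m (cut k m) = ((k : ℤ), 4 * (k : ℤ) ^ 2 - 4 * k + 1) := by
  simp [coord, ha]

lemma det3_pos_iff_of_pos {k m a b d : ℕ} (h : 0 < det3 (coord k m a) (coord k m b) (coord k m d))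
    (h' : CoordPos k m a b d) :
    (0 < det3 (coord k m a) (coord k m b) (coord k m d) ↔ CoordPos k m a b d) ∧
      det3 (coord k m a) (coord k m b) (coord k m d) ≠ 0 :=
  ⟨iff_of_true h h', h.ne'⟩

lemma det3_pos_iff_of_neg {k m a b d : ℕ} (h : det3 (coord k m a) (coord k m b) (coord k m d) < 0)
    (h' : ¬ CoordPos k m a b d) :
    (0 < det3 (coord k m a) (coord k m b) (coord k m d) ↔ CoordPos k m a b d) ∧
      det3 (coord k m a) (coord k m b) (coord k m d) ≠ 0 :=
  ⟨iff_of_false h.le.not_gt h', h.ne⟩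

lemma det3_pos_iff_of_key_lt {k m a b d : ℕ} (hk : 3 ≤ k) (hm : m ≤ 2 * k) (ha : a ≤ 2 * k)
    (hb : b ≤ 2 * k) (hd : d ≤ 2 * k) (ham : a ≠ m) (hbm : b ≠ m) (hdm : d ≠ m)
    (hab : key k m a < key k m b) (hbd : key k m b < key k m d) :
    (0 < det3 (coord k m a) (coord k m b) (coord k m d) ↔ CoordPos k m a b d) ∧
      det3 (coord k m a) (coord k m b) (coord k m d) ≠ 0 := by
  have key_nonneg : 0 ≤ key k m a := by
    rcases ha.lt_or_eq with h | rfl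
    · linarith [(key_bounds hk hm h ham).1]
    · rw [key_outer]
  have hb' : b < 2 * k := by
    refine hb.lt_of_ne fun h => ?_
    rw [h, key_outer] at hab; omega
  have hd' : d < 2 * k := by
    refine hd.lt_of_ne fun h => ?_
    rw [h, key_outer] at hbd; omega
  obtain ⟨b1, b2, b3, b4, b5⟩ := key_bounds hk hm hb' hbm
  obtain ⟨d1, d2, d3, d4, d5⟩ := key_bounds hk hm hd' hdm
  have hbc : b ≠ cut k m := fun h => by have := b3.2 h; omega
  have hu : (b : ℤ) % 2 = 0 ∨ (b : ℤ) % 2 = 1 := by omega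
  have hv : (d : ℤ) % 2 = 0 ∨ (d : ℤ) % 2 = 1 := by omega
  rcases ha.lt_or_eq with ha' | rfl
  · obtain ⟨a1, a2, a3, a4, a5⟩ := key_bounds hk hm ha' ham
    have hac : a ≠ cut k m := fun h => by have := a3.2 h; omega
    have hw : (a : ℤ) % 2 = 0 ∨ (a : ℤ) % 2 = 1 := by omega
    have hC : CoordPos k m a b d ↔ Pos k a b d := by
      simp [CoordPos, ha'.ne, hb'.ne, hd'.ne]
    rw [pos_iff_of_key hk hm ha' hb' hd' hdm hab hbd] at hC
    by_cases hdc : d = cut k m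
    · have hm' := d4 (d3.2 hdc)
      have hcut : cut k m = 2 * k - 1 := by simp [cut, hm']
      have hdk := d3.2 hdc
      have hdet : det3 (coord k m a) (coord k m b) (coord k m d) =
          (key k m b - key k m a) *
            (2 * ((k : ℤ) - 1) ^ 2 - 1 + 2 * (key k m a - k) * (key k m b - k))
            - 4 * ((a : ℤ) % 2) * (key k m b - k) + 4 * ((b : ℤ) % 2) * (key k m a - k) := by
        rw [coord_chain ha'.ne hac, coord_chain hb'.ne hbc, hdc, coord_cut (by omega)]
        simp only [det3]
        ring
      by_cases hx : key k m a = 1 ∧ key k m b = 2 * k - 1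
      · have e1 : (a : ℤ) % 2 = 0 := by omega
        have e2 : (b : ℤ) % 2 = 0 := by omega
        refine det3_pos_iff_of_neg ?_ ?_
        · rw [hdet, e1, e2, hx.1, hx.2]
          nlinarith [show (3 : ℤ) ≤ k by exact_mod_cast hk]
        · rw [hC, not_not]
          exact Or.inr ⟨hm', hx.1, hx.2, hdk⟩
      · refine det3_pos_iff_of_pos ?_ ?_
        · rw [hdet]
          exact below_pos (k := k) (by exact_mod_cast hk) hab a1 (by lia) hw hu (by omega)
            (by omega) hx
        · rw [hC]
          rintro (⟨h1, h2, h3⟩ | ⟨h1, h2, h3, h4⟩)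
          · omega
          · exact hx ⟨h2, h3⟩
    · have hdet : det3 (coord k m a) (coord k m b) (coord k m d) =
          2 * ((key k m b - key k m a) * (key k m d - key k m b) *
            ((key k m b - key k m a) + (key k m d - key k m b)) +
            2 * ((key k m b - key k m a) * ((d : ℤ) % 2) + (key k m d - key k m b) * ((a : ℤ) % 2)
              - ((key k m b - key k m a) + (key k m d - key k m b)) * ((b : ℤ) % 2))) := by
        rw [coord_chain ha'.ne hac, coord_chain hb'.ne hbc, coord_chain hd'.ne hdc]
        simp only [det3]
        ring
      have hdk : key k m d ≠ 2 * k := fun h => hdc (d3.1 h)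
      by_cases hx : (b : ℤ) % 2 = 1 ∧ key k m b - key k m a = 1 ∧ key k m d - key k m b = 1
      · have e1 : (a : ℤ) % 2 = 0 := by omega
        have e2 : (d : ℤ) % 2 = 0 := by omega
        refine det3_pos_iff_of_neg ?_ ?_
        · rw [hdet, e1, e2, hx.1, hx.2.1, hx.2.2]
          norm_num
        · rw [hC, not_not]
          exact Or.inl (by omega)
      · refine det3_pos_iff_of_pos ?_ ?_
        · rw [hdet]
          have := chain_pos (by omega) (by omega) hw hu hv (by omega) (by omega) hx
          linarith
        · rw [hC]
          rintro (⟨h1, h2, h3⟩ | ⟨h1, h2, h3, h4⟩)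
          · omega
          · exact hdk h4
  · have hm' : m ≠ 2 * k := fun h => ham h.symm
    have hdc : d ≠ cut k m := fun h => hm' (d4 (d3.2 h))
    have hdk : key k m d ≠ 2 * k := fun h => hm' (d4 h)
    refine det3_pos_iff_of_neg ?_ ?_
    · rw [coord_outer, coord_chain hb'.ne hbc, coord_chain hd'.ne hdc]
      simp only [det3]
      have hd2 : key k m d ≤ 2 * k - 1 := by omega
      generalize key k m b = s at *
      generalize key k m d = t at *
      have h1 : s * t ≤ (2 * k - 1) * (2 * k - 1) := by nlinarith
      rcases hu with hu | hu <;> rcases hv with hv | hv <;> rw [hu, hv] <;>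
        nlinarith
    · simp only [CoordPos, hb'.ne, hd'.ne]
      simp
      exact hbd.le

lemma cyc_rotate {a b d : ℕ} : Cyc b d a ↔ Cyc a b d := by
  unfold Cyc; tauto

lemma cyc_swap {a b d : ℕ} (hab : a ≠ b) (had : a ≠ d) (hbd : b ≠ d) :
    Cyc b a d ↔ ¬ Cyc a b d := by
  unfold Cyc; omega

lemma reflex_rotate {k a b d : ℕ} : Reflex k b d a ↔ Reflex k a b d := by
  unfold Reflex; tauto

lemma reflex_swap {k a b d : ℕ} : Reflex k b a d ↔ Reflex k a b d := by
  unfold Reflex; tauto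

lemma pos_rotate {k a b d : ℕ} : Pos k b d a ↔ Pos k a b d := by
  rw [Pos, Pos, cyc_rotate, reflex_rotate]

lemma pos_swap {k a b d : ℕ} (hab : a ≠ b) (had : a ≠ d) (hbd : b ≠ d) :
    Pos k b a d ↔ ¬ Pos k a b d := by
  rw [Pos, Pos, cyc_swap hab had hbd, reflex_swap]
  tauto

lemma coordPos_rotate {k m a b d : ℕ} : CoordPos k m b d a ↔ CoordPos k m a b d := by
  unfold CoordPos
  rw [pos_rotate]
  tauto

lemma coordPos_outer_left {k m b d : ℕ} (hb : b ≠ 2 * k) (hd : d ≠ 2 * k) :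
    CoordPos k m (2 * k) b d ↔ key k m d < key k m b := by
  simp [CoordPos, hb, hd]

lemma coordPos_outer_middle {k m a d : ℕ} (ha : a ≠ 2 * k) (hd : d ≠ 2 * k) :
    CoordPos k m a (2 * k) d ↔ key k m a < key k m d := by
  simp [CoordPos, ha, hd]

lemma coordPos_iff_pos {k m a b d : ℕ} (ha : a ≠ 2 * k) (hb : b ≠ 2 * k) (hd : d ≠ 2 * k) :
    CoordPos k m a b d ↔ Pos k a b d := by
  simp [CoordPos, ha, hb, hd]

lemma coordPos_outer_right {k m a b : ℕ} (ha : a ≠ 2 * k) (hb : b ≠ 2 * k) :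
    CoordPos k m a b (2 * k) ↔ key k m b < key k m a := by
  simp [CoordPos, ha, hb]

lemma coordPos_swap {k m a b d : ℕ} (hab : a ≠ b) (had : a ≠ d) (hbd : b ≠ d)
    (hab' : key k m a ≠ key k m b) (had' : key k m a ≠ key k m d)
    (hbd' : key k m b ≠ key k m d) :
    CoordPos k m b a d ↔ ¬ CoordPos k m a b d := by
  by_cases ha : a = 2 * k
  · subst ha
    rw [coordPos_outer_middle hab.symm had.symm, coordPos_outer_left hab.symm had.symm]
    omega
  by_cases hb : b = 2 * k
  · subst hb
    rw [coordPos_outer_middle hab hbd.symm, coordPos_outer_left hab hbd.symm]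
    omega
  by_cases hd : d = 2 * k
  · subst hd
    rw [coordPos_outer_right had hbd, coordPos_outer_right hbd had]
    omega
  rw [coordPos_iff_pos ha hb hd, coordPos_iff_pos hb ha hd, pos_swap hab had hbd]

lemma det3_rotate (A B C : ℤ × ℤ) : det3 B C A = det3 A B C := by
  simp only [det3]; ring

lemma det3_swap (A B C : ℤ × ℤ) : det3 B A C = -det3 A B C := by
  simp only [det3]; ring

theorem det3_coord {k m a b d : ℕ} (hk : 3 ≤ k) (hm : m ≤ 2 * k) (ha : a ≤ 2 * k)
    (hb : b ≤ 2 * k) (hd : d ≤ 2 * k) (ham : a ≠ m) (hbm : b ≠ m) (hdm : d ≠ m)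
    (hab : a ≠ b) (had : a ≠ d) (hbd : b ≠ d) :
    (0 < det3 (coord k m a) (coord k m b) (coord k m d) ↔ CoordPos k m a b d) ∧
      det3 (coord k m a) (coord k m b) (coord k m d) ≠ 0 := by
  have hab' : key k m a ≠ key k m b := fun h =>
    hab (key_inj hk hm (Nat.lt_succ_of_le ha) (Nat.lt_succ_of_le hb) h)
  have had' : key k m a ≠ key k m d := fun h =>
    had (key_inj hk hm (Nat.lt_succ_of_le ha) (Nat.lt_succ_of_le hd) h)
  have hbd' : key k m b ≠ key k m d := fun h =>
    hbd (key_inj hk hm (Nat.lt_succ_of_le hb) (Nat.lt_succ_of_le hd) h)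
  have flip : ∀ {x y : ℤ} {p q : Prop}, ((0 < x ↔ p) ∧ x ≠ 0) → y = -x → (p ↔ ¬ q) →
      ((0 < y ↔ q) ∧ y ≠ 0) := by
    rintro x y p q ⟨h1, h2⟩ rfl h3
    refine ⟨?_, neg_ne_zero.2 h2⟩
    have : 0 < -x ↔ ¬ 0 < x := by omega
    rw [this, h1, h3, not_not]
  have hswap := coordPos_swap hab had hbd hab' had' hbd'
  rcases hab'.lt_or_gt with h1 | h1 <;> rcases hbd'.lt_or_gt with h2 | h2
  · exact det3_pos_iff_of_key_lt hk hm ha hb hd ham hbm hdm h1 h2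
  · rcases had'.lt_or_gt with h3 | h3
    · refine flip (det3_pos_iff_of_key_lt hk hm ha hd hb ham hdm hbm h3 h2) ?_ ?_
      · rw [det3_rotate, det3_swap]
      · exact coordPos_rotate.trans hswap
    · have := det3_pos_iff_of_key_lt hk hm hd ha hb hdm ham hbm h3 h1
      rwa [← det3_rotate, ← coordPos_rotate] at this
  · rcases had'.lt_or_gt with h3 | h3
    · refine flip (det3_pos_iff_of_key_lt hk hm hb ha hd hbm ham hdm h1 h3) ?_ hswap
      exact det3_swap _ _ _
    · have := det3_pos_iff_of_key_lt hk hm hb hd ha hbm hdm ham h2 h3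
      rwa [det3_rotate, coordPos_rotate] at this
  · refine flip (det3_pos_iff_of_key_lt hk hm hd hb ha hdm hbm ham h2 h1) ?_ ?_
    · rw [det3_rotate, det3_rotate, det3_swap]
    · exact coordPos_rotate.trans (coordPos_rotate.trans hswap)

lemma twoOf_rotate {p q r : Prop} : TwoOf q r p ↔ TwoOf p q r := by
  unfold TwoOf; tauto

lemma cyc_iff_key {k m a b d : ℕ} (hm : m < 2 * k) (ha : a < 2 * k) (hb : b < 2 * k)
    (hd : d < 2 * k) :
    Cyc a b d ↔ (key k m a < key k m b ∧ key k m b < key k m d) ∨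
      (key k m b < key k m d ∧ key k m d < key k m a) ∨
      (key k m d < key k m a ∧ key k m a < key k m b) := by
  simp only [key, cut, Cyc, ha.ne, hb.ne, hd.ne, hm.ne, if_false]
  split_ifs <;> omega

lemma odd_iff_of_reflex {k m a b d : ℕ} (hk : 3 ≤ k) (hm : m < 2 * k) (ha : a < 2 * k)
    (hb : b < 2 * k) (hd : d < 2 * k) (ham : a ≠ m) (hbm : b ≠ m) (hdm : d ≠ m)
    (hab : a ≠ b) (had : a ≠ d) (hbd : b ≠ d) (h : Reflex k a b d) :
    a % 2 = 1 ↔ (key k m a < key k m b ↔ key k m d < key k m a) := by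
  simp only [key, cut, ha.ne, hb.ne, hd.ne, hm.ne, if_false]
  rcases h with ⟨⟨h1, h2⟩, -, h3⟩ | ⟨⟨h1, h2⟩, -, h3⟩ | ⟨⟨h1, h2⟩, -, h3⟩ <;>
    rcases h2 with h2 | h2 | h2 <;> rcases h3 with h3 | h3 | h3 <;>
    split_ifs <;> omega

lemma twoOf_key_iff_outerPos {k m a b d : ℕ} (hk : 3 ≤ k) (hm : m < 2 * k) (ha : a < 2 * k)
    (hb : b < 2 * k) (hd : d < 2 * k) (ham : a ≠ m) (hbm : b ≠ m) (hdm : d ≠ m)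
    (hab : a ≠ b) (had : a ≠ d) (hbd : b ≠ d) :
    TwoOf (key k m a < key k m b) (Pos k a b d) (key k m d < key k m a) ↔ OuterPos k a b d := by
  have hcyc := cyc_iff_key hm ha hb hd
  have hab' : key k m a ≠ key k m b := fun h => hab (key_inj hk hm.le (by omega) (by omega) h)
  have had' : key k m a ≠ key k m d := fun h => had (key_inj hk hm.le (by omega) (by omega) h)
  have hodd := odd_iff_of_reflex hk hm ha hb hd ham hbm hdm hab had hbd
  have hcyc' : (key k m a < key k m b ↔ key k m d < key k m a) →
      (Cyc a b d ↔ key k m a < key k m b) := by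
    rw [hcyc]; omega
  unfold OuterPos TwoOf Pos
  clear hcyc
  revert hodd hcyc'
  generalize (key k m a < key k m b) = A
  generalize (key k m d < key k m a) = D
  generalize Cyc a b d = C
  generalize Reflex k a b d = R
  rcases Nat.mod_two_eq_zero_or_one a with h | h <;> rw [h] <;> by_cases A <;> by_cases D <;>
    by_cases C <;> by_cases R <;> simp [*]

lemma twoOf_coordPos_iff {k m i j l r : ℕ} (hk : 3 ≤ k) (hm : m ≤ 2 * k) (hi : i ≤ 2 * k)
    (hj : j ≤ 2 * k) (hl : l ≤ 2 * k) (hr : r ≤ 2 * k) (him : i ≠ m) (hjm : j ≠ m) (hlm : l ≠ m)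
    (hrm : r ≠ m) (hij : i ≠ j) (hil : i ≠ l) (hir : i ≠ r) (hjl : j ≠ l) (hjr : j ≠ r)
    (hlr : l ≠ r) :
    TwoOf (CoordPos k m i j l) (CoordPos k m i l r) (CoordPos k m i r j) ↔ Radial k i j l r := by
  by_cases h0 : i = 2 * k
  · subst h0
    rw [radial_outer_iff, coordPos_outer_left hij.symm hil.symm,
      coordPos_outer_left hil.symm hir.symm, coordPos_outer_left hir.symm hij.symm,
      cyc_iff_key (k := k) (m := m) (by omega) (by omega) (by omega) (by omega), TwoOf]
    tauto
  by_cases h1 : j = 2 * k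
  · subst h1
    rw [radial_iff_outerPos₁ h0 hjl.symm hjr.symm, coordPos_outer_middle h0 hjl.symm,
      coordPos_iff_pos h0 hjl.symm hjr.symm, coordPos_outer_right h0 hjr.symm,
      twoOf_key_iff_outerPos hk] <;> omega
  by_cases h2 : l = 2 * k
  · subst h2
    rw [radial_iff_outerPos₂ h0 h1 hlr.symm, coordPos_outer_right h0 h1,
      coordPos_outer_middle h0 hlr.symm, coordPos_iff_pos h0 hlr.symm h1, ← twoOf_rotate,
      twoOf_key_iff_outerPos hk] <;> omega
  by_cases h3 : r = 2 * k
  · subst h3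
    rw [radial_iff_outerPos₃ h0 h1 h2, coordPos_iff_pos h0 h1 h2, coordPos_outer_right h0 h2,
      coordPos_outer_middle h0 h1, twoOf_rotate,
      twoOf_key_iff_outerPos hk] <;> omega
  rw [radial_iff_twoOf h0 h1 h2 h3, coordPos_iff_pos h0 h1 h2, coordPos_iff_pos h0 h2 h3,
    coordPos_iff_pos h0 h3 h1]

lemma orient_cast (A B C : ℤ × ℤ) :
    orient (A.1, A.2) (B.1, B.2) (C.1, C.2) = (det3 A B C : ℝ) := by
  simp only [orient_eq, det3]; push_cast; ring

theorem exists_realization {k : ℕ} (hk : 3 ≤ k) (m : Fin (2 * k + 1)) :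
    ∃ P : {x : Fin (2 * k + 1) // x ≠ m} → ℝ × ℝ, Function.Injective P ∧ GenPos P ∧
      ∀ i j l r : {x : Fin (2 * k + 1) // x ≠ m}, Admissible i j l r →
        (Ccw P i j l r ↔ Radial k i.1 j.1 l.1 r.1) := by
  have hle (x : Fin (2 * k + 1)) : (x : ℕ) ≤ 2 * k := Nat.le_of_lt_succ x.2
  have hne (x : {x : Fin (2 * k + 1) // x ≠ m}) : (x.1 : ℕ) ≠ m := Fin.val_ne_of_ne x.2
  have hinj {x y : {x : Fin (2 * k + 1) // x ≠ m}} (h : x ≠ y) : (x.1 : ℕ) ≠ y.1 := fun h' =>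
    h (Subtype.ext (Fin.ext h'))
  have hdet {x y z : {x : Fin (2 * k + 1) // x ≠ m}} (hxy : x ≠ y) (hxz : x ≠ z) (hyz : y ≠ z) :=
    det3_coord hk (hle m) (hle x.1) (hle y.1) (hle z.1) (hne x) (hne y) (hne z)
      (hinj hxy) (hinj hxz) (hinj hyz)
  let P : {x : Fin (2 * k + 1) // x ≠ m} → ℝ × ℝ :=
    fun x => ((coord k m x.1).1, (coord k m x.1).2)
  have horient (x y z) : orient (P x) (P y) (P z) =
      (det3 (coord k m x.1) (coord k m y.1) (coord k m z.1) : ℝ) := orient_cast _ _ _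
  have hP : GenPos P := fun x y z hxy hxz hyz => by
    rw [chi_ne_zero_iff, horient]
    exact_mod_cast (hdet hxy hxz hyz).2
  refine ⟨P, fun x y hxy => ?_, hP, ?_⟩
  · by_contra hne'
    obtain ⟨z, hz⟩ := Finset.exists_mem_notMem_of_card_lt_card
      (s := {x.1, y.1, m}) (t := Finset.univ) (by
        rw [Finset.card_univ, Fintype.card_fin]
        exact Finset.card_le_three.trans_lt (by omega))
    simp only [Finset.mem_insert, Finset.mem_singleton, not_or] at hz
    have := hP x y ⟨z, hz.2.2.2⟩ hne' (fun h => hz.2.1 (h ▸ rfl)) (fun h => hz.2.2.1 (h ▸ rfl))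
    rw [chi_ne_zero_iff, hxy, orient_eq] at this
    exact this (by ring)
  · rintro i j l r ⟨hij, hil, hir, hjl, hjr, hlr⟩
    rw [ccw_iff, horient, horient, horient, Int.cast_pos, Int.cast_pos, Int.cast_pos,
      (hdet hij hil hjl).1, (hdet hil hir hlr).1, (hdet hir hij hjr.symm).1]
    exact twoOf_coordPos_iff hk (hle m) (hle i.1) (hle j.1) (hle l.1) (hle r.1) (hne i) (hne j)
      (hne l) (hne r) (hinj hij) (hinj hil) (hinj hir) (hinj hjl) (hinj hjr) (hinj hlr)

end RadialSystem

/-- for every `k ≥ 3` there is a radial system on `2k+1` points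
that is not realizable by any planar point set, but becomes realizable upon
removal of any single point. -/
theorem minimal_nonrealizable_radial_system (k : ℕ) (hk : 3 ≤ k) :
    ∃ R : Fin (2 * k + 1) → Fin (2 * k + 1) → Fin (2 * k + 1) → Fin (2 * k + 1) → Prop,
      (¬ ∃ P : Fin (2 * k + 1) → ℝ × ℝ, Function.Injective P ∧ GenPos P ∧
          ∀ i j k' l : Fin (2 * k + 1), Admissible i j k' l →
            (Ccw P i j k' l ↔ R i j k' l)) ∧
      (∀ m : Fin (2 * k + 1), ∃ P : {x : Fin (2 * k + 1) // x ≠ m} → ℝ × ℝ,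
          Function.Injective P ∧ GenPos P ∧
          ∀ i j k' l : {x : Fin (2 * k + 1) // x ≠ m}, Admissible i j k' l →
            (Ccw P i j k' l ↔ R i.1 j.1 k'.1 l.1)) := by
  refine ⟨fun i j l r => RadialSystem.Radial k i j l r, ?_,
    fun m => RadialSystem.exists_realization hk m⟩
  rintro ⟨P, -, hP, hR⟩
  exact RadialSystem.not_realizable hk P hP hR
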